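/- For all 1 ≤ i < j ≤ n one has in 𝒟_n: E_{i,j} = −q Σ_{s=−j}^{j−1} E_{i,j−1}^{↑s_+} w_j^s = −q Σ_{s=−i}^{i−1} w_i^s E_{i+1,j}^{↓s_−}, and for every i < r < j also E_{i,j} = q² Σ_{s=−r}^{r−1} E_{i,r−1}^{↑s_+} w_r^s E_{r+1,j}^{↓s_−}. Likewise F_{i,j} = Σ_{s=−θ(j)}^{θ(j)−1} F_{i,j−1}^{↑s_+} m_{θ(j)}^s = Σ_{s=−θ(i)}^{θ(i)−1} m_{θ(i)}^s F_{i+1,j}^{↓s_−}, and for every i < r < j also F_{i,j} = Σ_{s=−θ(r)}^{θ(r)−1} F_{i,r−1}^{↑s_+} m_{θ(r)}^s F_{r+1,j}^{↓s_−}. -/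

import Mathlib

noncomputable section

/-- The ground field `𝕂 = ℂ(q)`, the field of rational functions over `ℂ`. -/
abbrev Kq : Type := RatFunc ℂ

/-- The formal variable `q ∈ ℂ(q)`. -/
def qq : Kq := RatFunc.X

/-- `𝐢 = √−1 ∈ ℂ`, viewed as a constant in `𝕂 = ℂ(q)`. -/
def ii : Kq := RatFunc.C Complex.I

/-- `θ(i) = n + 1 − i`. -/
def th (n : ℕ) (i : ℤ) : ℤ := (n : ℤ) + 1 - i

/-- Labels for the vertices of the `𝒟ₙ`-quiver: `V i r` stands for `V_{i,r}`
(the canonical labels), and `C i` stands for the central vertex `Λ_{i,0}`. -/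
inductive DnLabel : Type
  | V : ℤ → ℤ → DnLabel
  | C : ℤ → DnLabel
deriving DecidableEq

/-- Validity of a label for given rank `n`: `V i r` requires `1 ≤ i ≤ n`, `−i ≤ r ≤ i`;
`C i` requires `1 ≤ i ≤ n`.  There are `n² + 3n` valid labels. -/
def DnLabel.valid (n : ℕ) : DnLabel → Prop
  | .V i r => 1 ≤ i ∧ i ≤ (n : ℤ) ∧ -i ≤ r ∧ r ≤ i
  | .C i => 1 ≤ i ∧ i ≤ (n : ℤ)

instance (n : ℕ) (v : DnLabel) : Decidable (v.valid n) := by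
  cases v <;> unfold DnLabel.valid <;> infer_instance

/-- The vertex set of the `𝒟ₙ`-quiver. -/
def DnVertex (n : ℕ) := {v : DnLabel // v.valid n}

/-- The canonical label of the vertex `Λ_{i,r}`, using the identifications
`Λ_{a,b} = V_{θ(b),−θ(a)}` for `b > 0` and `Λ_{a,b} = V_{θ(−b),θ(a)}` for `b < 0`. -/
def Lam (n : ℕ) (i r : ℤ) : DnLabel :=
  if 0 < r then .V (th n r) (-(th n i))
  else if r < 0 then .V (th n (-r)) (th n i)
  else .C i

/-- The list of arrows `(source, target, doubled weight)` of the `𝒟ₙ`-quiver, obtained by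
amalgamating two copies of the Fock–Goncharov `(n+1)`-triangle quiver along two pairs of
sides.  Solid (weight `1`) arrows get doubled weight `2`, dashed (weight `1/2`) arrows get
doubled weight `1`.  The families are: the horizontal `V_i`- and `Λ_i`-path arrows, the
dashed boundary arrows along the two frozen columns, and, for each `1 ≤ i < n`, the
oriented cycle `V_{i,0} → V_{i+1,−1} → ⋯ → V_{n,i−n} → Λ_{i,0} → V_{n,n−i} → ⋯ → V_{i+1,1} → V_{i,0}`
through the central column. -/
def dnArrows (n : ℕ) : List (DnLabel × DnLabel × ℤ) :=
  ((List.range n).flatMap fun i0 =>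
    (List.range (2 * i0 + 2)).map fun k =>
      (DnLabel.V ((i0 : ℤ) + 1) (-((i0 : ℤ) + 1) + k),
       DnLabel.V ((i0 : ℤ) + 1) (-((i0 : ℤ) + 1) + k + 1), 2))
  ++ ((List.range n).flatMap fun i0 =>
    (List.range (2 * i0 + 2)).map fun k =>
      (Lam n ((i0 : ℤ) + 1) (-((i0 : ℤ) + 1) + k),
       Lam n ((i0 : ℤ) + 1) (-((i0 : ℤ) + 1) + k + 1), 2))
  ++ ((List.range (n - 1)).map fun i0 =>
      (DnLabel.V ((i0 : ℤ) + 1) (-((i0 : ℤ) + 1)),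
       DnLabel.V ((i0 : ℤ) + 2) (-((i0 : ℤ) + 2)), 1))
  ++ ((List.range (n - 1)).map fun i0 =>
      (DnLabel.V ((i0 : ℤ) + 2) ((i0 : ℤ) + 2),
       DnLabel.V ((i0 : ℤ) + 1) ((i0 : ℤ) + 1), 1))
  ++ ((List.range (n - 1)).flatMap fun i0 =>
      (((List.range (n - 1 - i0)).map fun k =>
          (DnLabel.V ((i0 : ℤ) + 1 + k) (-(k : ℤ)),
           DnLabel.V ((i0 : ℤ) + 2 + k) (-(k : ℤ) - 1), 2))
        ++ [(DnLabel.V (n : ℤ) ((i0 : ℤ) + 1 - n), DnLabel.C ((i0 : ℤ) + 1), 2),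
            (DnLabel.C ((i0 : ℤ) + 1), DnLabel.V (n : ℤ) ((n : ℤ) - (i0 + 1)), 2)]
        ++ ((List.range (n - 1 - i0)).map fun k =>
          (DnLabel.V ((i0 : ℤ) + 2 + k) ((k : ℤ) + 1),
           DnLabel.V ((i0 : ℤ) + 1 + k) (k : ℤ), 2))))

/-- The doubled exchange matrix `2·ε_{uv}` of the `𝒟ₙ`-quiver. -/
def eps2 (n : ℕ) (u v : DnLabel) : ℤ :=
  ((dnArrows n).map fun a =>
    (if a.1 = u ∧ a.2.1 = v then a.2.2 else 0)
      - (if a.1 = v ∧ a.2.1 = u then a.2.2 else 0)).sum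

/-- The defining relations of the quantum torus algebra `𝒟ₙ`: generators `X_v^{±1}`
(`Sum.inl v` is `X_v`, `Sum.inr v` is `X_v⁻¹`) with `X_u X_v = q^{2 ε_{vu}} X_v X_u`. -/
inductive DnRel (n : ℕ) :
    FreeAlgebra Kq (DnVertex n ⊕ DnVertex n) →
      FreeAlgebra Kq (DnVertex n ⊕ DnVertex n) → Prop
  | comm (u v : DnVertex n) :
      DnRel n (FreeAlgebra.ι Kq (Sum.inl u) * FreeAlgebra.ι Kq (Sum.inl v))
        ((qq ^ eps2 n v.1 u.1) • (FreeAlgebra.ι Kq (Sum.inl v) * FreeAlgebra.ι Kq (Sum.inl u)))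
  | mul_inv (v : DnVertex n) :
      DnRel n (FreeAlgebra.ι Kq (Sum.inl v) * FreeAlgebra.ι Kq (Sum.inr v)) 1
  | inv_mul (v : DnVertex n) :
      DnRel n (FreeAlgebra.ι Kq (Sum.inr v) * FreeAlgebra.ι Kq (Sum.inl v)) 1

/-- The quantum torus algebra `𝒟ₙ`. -/
abbrev Dtorus (n : ℕ) := RingQuot (DnRel n)

/-- The cluster variable `X_v ∈ 𝒟ₙ` attached to a label (junk value `1` on invalid labels). -/
def Xg (n : ℕ) (v : DnLabel) : Dtorus n :=
  if h : v.valid n then RingQuot.mkAlgHom Kq (DnRel n) (FreeAlgebra.ι Kq (Sum.inl ⟨v, h⟩)) else 1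

/-- The inverse cluster variable `X_v⁻¹ ∈ 𝒟ₙ` (junk value `1` on invalid labels). -/
def Xinv (n : ℕ) (v : DnLabel) : Dtorus n :=
  if h : v.valid n then RingQuot.mkAlgHom Kq (DnRel n) (FreeAlgebra.ι Kq (Sum.inr ⟨v, h⟩)) else 1

/-- The ordered product `X_{V_{i,−i}} X_{V_{i,1−i}} ⋯ X_{V_{i,r}}`. -/
def Vprod (n : ℕ) (i r : ℤ) : Dtorus n :=
  ((List.range (r + i + 1).toNat).map fun k => Xg n (.V i (-i + k))).prod

/-- The ordered product `X_{Λ_{i,−i}} X_{Λ_{i,1−i}} ⋯ X_{Λ_{i,r}}`. -/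
def Lprod (n : ℕ) (i r : ℤ) : Dtorus n :=
  ((List.range (r + i + 1).toNat).map fun k => Xg n (Lam n i (-i + k))).prod

/-- `w_i^r = 𝐢 q^{i+r} X_{V_{i,−i}} X_{V_{i,1−i}} ⋯ X_{V_{i,r}}`. -/
def ww (n : ℕ) (i r : ℤ) : Dtorus n := (ii * qq ^ (i + r)) • Vprod n i r

/-- `m_i^r = 𝐢 q^{i+r} X_{Λ_{i,−i}} X_{Λ_{i,1−i}} ⋯ X_{Λ_{i,r}}`. -/
def mm (n : ℕ) (i r : ℤ) : Dtorus n := (ii * qq ^ (i + r)) • Lprod n i r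


/-- `E_i = Σ_{r=−i}^{i−1} w_i^r ∈ 𝒟ₙ`, the image of the Chevalley generator `E_i`. -/
def Ev (n : ℕ) (i : ℤ) : Dtorus n := ∑ r ∈ Finset.Icc (-i) (i - 1), ww n i r

/-- `F_j = Σ_{r=−θ(j)}^{θ(j)−1} m_{θ(j)}^r ∈ 𝒟ₙ`, the image of the Chevalley generator `F_j`. -/
def Fv (n : ℕ) (j : ℤ) : Dtorus n :=
  ∑ r ∈ Finset.Icc (-(th n j)) (th n j - 1), mm n (th n j) r

/-- Auxiliary recursion: `EEaux n i k = E_{i,i+k}`. -/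
def EEaux (n : ℕ) (i : ℤ) : ℕ → Dtorus n
  | 0 => Ev n i
  | k + 1 => (qq - qq⁻¹)⁻¹ •
      (EEaux n i k * Ev n (i + k + 1) - qq • (Ev n (i + k + 1) * EEaux n i k))

/-- The quantum root vector `E_{i,j}`, defined by `E_{i,i} = E_i` and
`E_{i,j} = (E_{i,j−1}E_j − qE_jE_{i,j−1})/(q−q^{−1})`. -/
def EE (n : ℕ) (i j : ℤ) : Dtorus n := EEaux n i (j - i).toNat

/-- Auxiliary recursion: `FFaux n i k = F_{i,i+k}`. -/
def FFaux (n : ℕ) (i : ℤ) : ℕ → Dtorus n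
  | 0 => Fv n i
  | k + 1 => (qq - qq⁻¹)⁻¹ •
      (Fv n (i + k + 1) * FFaux n i k - qq⁻¹ • (FFaux n i k * Fv n (i + k + 1)))

/-- The quantum root vector `F_{i,j}`, defined by `F_{i,i} = F_i` and
`F_{i,j} = (F_jF_{i,j−1} − q^{−1}F_{i,j−1}F_j)/(q−q^{−1})`. -/
def FF (n : ℕ) (i j : ℤ) : Dtorus n := FFaux n i (j - i).toNat

open Classical in
/-- The decomposition `x = x^− + x^+` with `y x^± = q^{±1} x^± y`; it is unique when it
exists (the first component is `x^−`, the second is `x^+`; junk value otherwise). -/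
def decompPM (n : ℕ) (y x : Dtorus n) : Dtorus n × Dtorus n :=
  if h : ∃ p : Dtorus n × Dtorus n,
      x = p.1 + p.2 ∧ y * p.1 = qq⁻¹ • (p.1 * y) ∧ y * p.2 = qq • (p.2 * y)
  then h.choose else (x, 0)

/-- The components `E_{i,j}^{↑s_∓}` of `E_{i,j}` with respect to `w_{j+1}^s`. -/
def Eup (n : ℕ) (i j s : ℤ) : Dtorus n × Dtorus n := decompPM n (ww n (j + 1) s) (EE n i j)

/-- The components `E_{i,j}^{↓r_∓}` of `E_{i,j}` with respect to `w_{i−1}^r`. -/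
def Edown (n : ℕ) (i j r : ℤ) : Dtorus n × Dtorus n := decompPM n (ww n (i - 1) r) (EE n i j)

/-- The components `F_{i,j}^{↑s_∓}` of `F_{i,j}` with respect to `m_{θ(j+1)}^s`. -/
def Fup (n : ℕ) (i j s : ℤ) : Dtorus n × Dtorus n :=
  decompPM n (mm n (th n (j + 1)) s) (FF n i j)

/-- The components `F_{i,j}^{↓r_∓}` of `F_{i,j}` with respect to `m_{θ(i−1)}^r`. -/
def Fdown (n : ℕ) (i j r : ℤ) : Dtorus n × Dtorus n :=
  decompPM n (mm n (th n (i - 1)) r) (FF n i j)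

section PathSums

variable {K A : Type*} [Field K] [Ring A] [Algebra K A]

/-- The weighted sum over the admissible paths in the rows `i, …, i + m - 1` that can be
continued by position `s` of row `i + m`. -/
def leftSum (I : ℤ → Finset ℤ) (w : ℤ → ℤ → A) (P : ℤ → ℤ → ℤ → Prop)
    [∀ k r s, Decidable (P k r s)] (c : K) (i : ℤ) : ℕ → ℤ → A
  | 0, _ => 1
  | m + 1, s => c • ∑ t ∈ (I (i + m)).filter (fun t => P (i + m) t s),
      leftSum I w P c i m t * w (i + m) t

/-- The weighted sum over the admissible paths in the rows `j - m + 1, …, j` that can be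
preceded by position `s` of row `j - m`. -/
def rightSum (I : ℤ → Finset ℤ) (w : ℤ → ℤ → A) (P : ℤ → ℤ → ℤ → Prop)
    [∀ k r s, Decidable (P k r s)] (c : K) (j : ℤ) : ℕ → ℤ → A
  | 0, _ => 1
  | m + 1, s => c • ∑ t ∈ (I (j - m)).filter (fun t => P (j - m - 1) s t),
      w (j - m) t * rightSum I w P c j m t

variable {I : ℤ → Finset ℤ} {w : ℤ → ℤ → A} {P : ℤ → ℤ → ℤ → Prop}
  [∀ k r s, Decidable (P k r s)] {c : K} {n : ℤ}

lemma sum_leftSum_mul_rightSum_succ (i j : ℤ) (m m' : ℕ) (h : j = i + m + (m' + 1)) :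
    ∑ s ∈ I (i + m), leftSum I w P c i m s * w (i + m) s * rightSum I w P c j (m' + 1) s =
      ∑ s ∈ I (i + m + 1),
        leftSum I w P c i (m + 1) s * w (i + m + 1) s * rightSum I w P c j m' s := by
  have e1 : j - m' = i + m + 1 := by omega
  simp only [leftSum, rightSum, e1, add_sub_cancel_right, Finset.sum_filter, Finset.smul_sum,
    Finset.mul_sum, Finset.sum_mul]
  rw [Finset.sum_comm]
  refine Finset.sum_congr rfl fun s _ => Finset.sum_congr rfl fun t _ => ?_
  split_ifs <;> simp [mul_assoc]

lemma sum_leftSum_mul_rightSum (i j : ℤ) (m m' : ℕ) (h : j = i + m + m') :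
    ∑ s ∈ I (i + m), leftSum I w P c i m s * w (i + m) s * rightSum I w P c j m' s =
      ∑ s ∈ I j, leftSum I w P c i (m + m') s * w j s := by
  induction m' generalizing m with
  | zero =>
    obtain rfl : j = i + m := by simpa using h
    simp [rightSum]
  | succ k ih =>
    rw [sum_leftSum_mul_rightSum_succ i j m k (by push_cast at h; exact h)]
    have := ih (m + 1) (by push_cast at h ⊢; omega)
    push_cast at this
    rw [add_assoc i, this, add_assoc m 1 k, add_comm 1 k]

lemma commute_leftSum
    (hfar : ∀ k l, 1 ≤ k → k + 2 ≤ l → l ≤ n → ∀ r ∈ I k, ∀ s ∈ I l, Commute (w l s) (w k r))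
    {i l : ℤ} (hi : 1 ≤ i) (hl : l ≤ n) {s : ℤ} (hs : s ∈ I l) (m : ℕ) (hm : i + m + 1 ≤ l)
    (t : ℤ) : Commute (w l s) (leftSum I w P c i m t) := by
  induction m generalizing t with
  | zero => exact Commute.one_right _
  | succ k ih =>
    push_cast at hm
    refine Commute.smul_right (Commute.sum_right _ _ _ fun u hu => ?_) c
    exact (ih (by omega) u).mul_right
      (hfar _ _ (by omega) (by omega) hl u (Finset.mem_filter.1 hu).1 s hs)

lemma commute_rightSum
    (hfar : ∀ k l, 1 ≤ k → k + 2 ≤ l → l ≤ n → ∀ r ∈ I k, ∀ s ∈ I l, Commute (w l s) (w k r))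
    {j k : ℤ} (hk : 1 ≤ k) (hj : j ≤ n) {s : ℤ} (hs : s ∈ I k) (m : ℕ) (hm : k + m + 1 ≤ j)
    (t : ℤ) : Commute (w k s) (rightSum I w P c j m t) := by
  induction m generalizing t with
  | zero => exact Commute.one_right _
  | succ p ih =>
    push_cast at hm
    refine Commute.smul_right (Commute.sum_right _ _ _ fun u hu => ?_) c
    exact (hfar _ _ hk (by omega) (by omega) s hs u (Finset.mem_filter.1 hu).1).symm.mul_right
      (ih (by omega) u)

variable {q : K}

/-- The part of `∑ a t * w (i + m) t` that `q`-commutes with `w (i + m + 1) s`. -/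
lemma mul_sum_leftSum
    (hfar : ∀ k l, 1 ≤ k → k + 2 ≤ l → l ≤ n → ∀ r ∈ I k, ∀ s ∈ I l, Commute (w l s) (w k r))
    {i : ℤ} (hi : 1 ≤ i) (m : ℕ) (hm : i + m + 1 ≤ n) {s : ℤ} (hs : s ∈ I (i + m + 1))
    (p : ℤ → Prop) [DecidablePred p] (e : K)
    (hp : ∀ t ∈ I (i + m), p t →
      w (i + m + 1) s * w (i + m) t = e • (w (i + m) t * w (i + m + 1) s)) :
    w (i + m + 1) s * (∑ t ∈ (I (i + m)).filter p, leftSum I w P c i m t * w (i + m) t) =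
      e • ((∑ t ∈ (I (i + m)).filter p, leftSum I w P c i m t * w (i + m) t) *
        w (i + m + 1) s) := by
  rw [Finset.mul_sum, Finset.sum_mul, Finset.smul_sum]
  refine Finset.sum_congr rfl fun t ht => ?_
  obtain ⟨h1, h2⟩ := Finset.mem_filter.1 ht
  rw [← mul_assoc, (commute_leftSum hfar hi hm hs m le_rfl t).eq, mul_assoc, hp t h1 h2]
  simp [mul_assoc]

lemma mul_sum_rightSum
    (hfar : ∀ k l, 1 ≤ k → k + 2 ≤ l → l ≤ n → ∀ r ∈ I k, ∀ s ∈ I l, Commute (w l s) (w k r))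
    {k j : ℤ} (hk : 1 ≤ k) (hj : j ≤ n) (m : ℕ) (hm : k + m + 1 = j) {s : ℤ} (hs : s ∈ I k)
    (p : ℤ → Prop) [DecidablePred p] (e : K)
    (hp : ∀ t ∈ I (k + 1), p t → w k s * w (k + 1) t = e • (w (k + 1) t * w k s)) :
    w k s * (∑ t ∈ (I (k + 1)).filter p, w (k + 1) t * rightSum I w P c j m t) =
      e • ((∑ t ∈ (I (k + 1)).filter p, w (k + 1) t * rightSum I w P c j m t) * w k s) := by
  rw [Finset.mul_sum, Finset.sum_mul, Finset.smul_sum]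
  refine Finset.sum_congr rfl fun t ht => ?_
  obtain ⟨h1, h2⟩ := Finset.mem_filter.1 ht
  rw [← mul_assoc, hp t h1 h2, mul_assoc _ _ (w k s),
    ← (commute_rightSum hfar hk hj hs m hm.le t).eq]
  simp [mul_assoc]

lemma rootVector_eq_sum_leftSum {u v : K} (hc : u + v * q = c) (hz : u + v * q⁻¹ = 0)
    (hfar : ∀ k l, 1 ≤ k → k + 2 ≤ l → l ≤ n → ∀ r ∈ I k, ∀ s ∈ I l, Commute (w l s) (w k r))
    (hpos : ∀ k, 1 ≤ k → k + 1 ≤ n → ∀ r ∈ I k, ∀ s ∈ I (k + 1), P k r s →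
      w (k + 1) s * w k r = q • (w k r * w (k + 1) s))
    (hneg : ∀ k, 1 ≤ k → k + 1 ≤ n → ∀ r ∈ I k, ∀ s ∈ I (k + 1), ¬ P k r s →
      w (k + 1) s * w k r = q⁻¹ • (w k r * w (k + 1) s))
    {X : ℤ → ℤ → A} (hX0 : ∀ i, X i i = ∑ r ∈ I i, w i r)
    (hX : ∀ i j, i ≤ j → X i (j + 1) =
      u • (X i j * X (j + 1) (j + 1)) + v • (X (j + 1) (j + 1) * X i j))
    {i : ℤ} (hi : 1 ≤ i) (m : ℕ) (hm : i + m ≤ n) :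
    X i (i + m) = ∑ s ∈ I (i + m), leftSum I w P c i m s * w (i + m) s := by
  induction m with
  | zero => simp [hX0, leftSum]
  | succ k ih =>
    push_cast at hm ⊢
    have hm' : i + k + 1 ≤ n := by omega
    rw [← add_assoc, hX i (i + k) (by omega), hX0, Finset.mul_sum, Finset.sum_mul,
      Finset.smul_sum, Finset.smul_sum, ← Finset.sum_add_distrib]
    refine Finset.sum_congr rfl fun s hs => ?_
    have h1 := mul_sum_leftSum (c := c) (P := P) hfar hi k hm' hs (fun t => P (i + k) t s) q
      fun t ht hp => hpos _ (by omega) hm' t ht s hs hp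
    have h2 := mul_sum_leftSum (c := c) (P := P) hfar hi k hm' hs (fun t => ¬ P (i + k) t s) q⁻¹
      fun t ht hp => hneg _ (by omega) hm' t ht s hs hp
    rw [ih (by omega), ← Finset.sum_filter_add_sum_filter_not _ (fun t => P (i + k) t s),
      mul_add, h1, h2, add_mul]
    simp only [leftSum]
    rw [← hc, smul_mul_assoc]
    have hu : u = -(v * q⁻¹) := eq_neg_of_add_eq_zero_left hz
    generalize (∑ t ∈ (I (i + k)).filter (fun t => P (i + k) t s), _) * w (i + k + 1) s = a
    generalize (∑ t ∈ (I (i + k)).filter (fun t => ¬ P (i + k) t s), _) * w (i + k + 1) s = b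
    rw [hu]
    module

lemma rootVector_path_decomposition {u v : K} (hc : u + v * q = c) (hz : u + v * q⁻¹ = 0)
    (hq : q ≠ 0)
    (hfar : ∀ k l, 1 ≤ k → k + 2 ≤ l → l ≤ n → ∀ r ∈ I k, ∀ s ∈ I l, Commute (w l s) (w k r))
    (hadj : ∀ k, 1 ≤ k → k + 1 ≤ n → ∀ r ∈ I k, ∀ s ∈ I (k + 1),
      w (k + 1) s * w k r = q • (w k r * w (k + 1) s) ∨
      w (k + 1) s * w k r = q⁻¹ • (w k r * w (k + 1) s))
    {X : ℤ → ℤ → A} (hX0 : ∀ i, X i i = ∑ r ∈ I i, w i r)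
    (hX : ∀ i j, i ≤ j → X i (j + 1) =
      u • (X i j * X (j + 1) (j + 1)) + v • (X (j + 1) (j + 1) * X i j))
    {D : A → A → A × A}
    (hD : ∀ k s a b, w k s * a = q⁻¹ • (a * w k s) → w k s * b = q • (b * w k s) →
      D (w k s) (a + b) = (a, b))
    {i j : ℤ} (hi : 1 ≤ i) (hij : i < j) (hj : j ≤ n) :
    (X i j = c • ∑ s ∈ I j, (D (w j s) (X i (j - 1))).2 * w j s) ∧
    (X i j = c • ∑ s ∈ I i, w i s * (D (w i s) (X (i + 1) j)).1) ∧
    (∀ r, i < r → r < j → X i j = (c * c) • ∑ s ∈ I r,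
      (D (w r s) (X i (r - 1))).2 * w r s * (D (w r s) (X (r + 1) j)).1) := by
  classical
  let P : ℤ → ℤ → ℤ → Prop := fun k r s => w (k + 1) s * w k r = q • (w k r * w (k + 1) s)
  have hpos : ∀ k, 1 ≤ k → k + 1 ≤ n → ∀ r ∈ I k, ∀ s ∈ I (k + 1), P k r s →
      w (k + 1) s * w k r = q • (w k r * w (k + 1) s) := fun k _ _ r _ s _ h => h
  have hneg : ∀ k, 1 ≤ k → k + 1 ≤ n → ∀ r ∈ I k, ∀ s ∈ I (k + 1), ¬ P k r s →
      w (k + 1) s * w k r = q⁻¹ • (w k r * w (k + 1) s) :=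
    fun k h1 h2 r hr s hs h => (hadj k h1 h2 r hr s hs).resolve_left h
  have hXL : ∀ i, 1 ≤ i → ∀ m : ℕ, i + m ≤ n →
      X i (i + m) = ∑ s ∈ I (i + m), leftSum I w P c i m s * w (i + m) s :=
    fun i hi m hm => rootVector_eq_sum_leftSum hc hz hfar hpos hneg hX0 hX hi m hm
  have hXM : ∀ i, 1 ≤ i → ∀ m m' : ℕ, i + m + m' ≤ n → X i (i + m + m') =
      ∑ s ∈ I (i + m), leftSum I w P c i m s * w (i + m) s *
        rightSum I w P c (i + m + m') m' s := by
    intro i hi m m' hm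
    rw [sum_leftSum_mul_rightSum i _ m m' rfl]
    have := hXL i hi (m + m') (by push_cast; omega)
    push_cast at this
    rwa [← add_assoc] at this
  have hup : ∀ i, 1 ≤ i → ∀ m : ℕ, i + m + 1 ≤ n → ∀ s ∈ I (i + m + 1),
      leftSum I w P c i (m + 1) s = c • (D (w (i + m + 1) s) (X i (i + m))).2 := by
    intro i hi m hm s hs
    rw [hXL i hi m (by omega),
      ← Finset.sum_filter_not_add_sum_filter _ (fun t => P (i + m) t s), hD]
    · rfl
    · exact mul_sum_leftSum hfar hi m hm hs _ _
        fun t ht hp => hneg _ (by omega) hm t ht s hs hp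
    · exact mul_sum_leftSum hfar hi m hm hs _ _
        fun t ht hp => hpos _ (by omega) hm t ht s hs hp
  have hdown : ∀ k, 1 ≤ k → ∀ m : ℕ, k + 1 + m ≤ n → ∀ s ∈ I k,
      rightSum I w P c (k + 1 + m) (m + 1) s = c • (D (w k s) (X (k + 1) (k + 1 + m))).1 := by
    intro k hk m hm s hs
    have h0 := hXM (k + 1) (by omega) 0 m (by simpa using hm)
    simp only [Nat.cast_zero, add_zero, leftSum, one_mul] at h0
    rw [h0, ← Finset.sum_filter_add_sum_filter_not _ (fun t => P k s t), hD]
    · simp only [rightSum, add_sub_cancel_right]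
    · refine mul_sum_rightSum hfar hk hm m (by omega) hs _ _ fun t ht hp => ?_
      rw [hpos k hk (by omega) s hs t ht hp, smul_smul, inv_mul_cancel₀ hq, one_smul]
    · refine mul_sum_rightSum hfar hk hm m (by omega) hs _ _ fun t ht hp => ?_
      rw [hneg k hk (by omega) s hs t ht hp, smul_smul, mul_inv_cancel₀ hq, one_smul]
  refine ⟨?_, ?_, fun r hir hrj => ?_⟩
  · obtain ⟨m, rfl⟩ : ∃ m : ℕ, j = i + m + 1 := ⟨(j - i - 1).toNat, by omega⟩
    have := hXL i hi (m + 1) (by push_cast; omega)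
    push_cast at this
    rw [← add_assoc] at this
    rw [this, Finset.smul_sum, add_sub_cancel_right]
    refine Finset.sum_congr rfl fun s hs => ?_
    rw [hup i hi m hj s hs, smul_mul_assoc]
  · obtain ⟨m, rfl⟩ : ∃ m : ℕ, j = i + 1 + m := ⟨(j - i - 1).toNat, by omega⟩
    have h0 := hXM i hi 0 (m + 1) (by push_cast; omega)
    have e : i + ((0 : ℕ) : ℤ) + ((m + 1 : ℕ) : ℤ) = i + 1 + m := by push_cast; ring
    rw [e] at h0
    simp only [Nat.cast_zero, add_zero] at h0
    rw [h0, Finset.smul_sum]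
    refine Finset.sum_congr rfl fun s hs => ?_
    rw [hdown i hi m hj s hs, mul_smul_comm]
    simp [leftSum]
  · obtain ⟨m, rfl⟩ : ∃ m : ℕ, r = i + m + 1 := ⟨(r - i - 1).toNat, by omega⟩
    obtain ⟨m', rfl⟩ : ∃ m' : ℕ, j = i + m + 1 + 1 + m' :=
      ⟨(j - (i + m + 1) - 1).toNat, by omega⟩
    have h0 := hXM i hi (m + 1) (m' + 1) (by push_cast; omega)
    have e : i + ((m + 1 : ℕ) : ℤ) + ((m' + 1 : ℕ) : ℤ) = i + m + 1 + 1 + m' := by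
      push_cast; ring
    have e' : i + ((m + 1 : ℕ) : ℤ) = i + m + 1 := by push_cast; ring
    rw [e, e'] at h0
    rw [h0, Finset.smul_sum, add_sub_cancel_right]
    refine Finset.sum_congr rfl fun s hs => ?_
    rw [hup i hi m (by omega) s hs, hdown (i + m + 1) (by omega) m' hj s hs]
    simp only [smul_mul_assoc, mul_smul_comm, smul_smul]

end PathSums

/-- The total doubled weight of the arrows from `u` to `v` in a list of arrows. -/
def arrowWeight (l : List (DnLabel × DnLabel × ℤ)) (u v : DnLabel) : ℤ :=
  (l.map fun a => if a.1 = u ∧ a.2.1 = v then a.2.2 else 0).sum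

lemma eps2_eq_arrowWeight_sub (n : ℕ) (u v : DnLabel) :
    eps2 n u v = arrowWeight (dnArrows n) u v - arrowWeight (dnArrows n) v u := by
  unfold eps2 arrowWeight
  induction dnArrows n with
  | nil => simp
  | cons a l ih => simp only [List.map_cons, List.sum_cons, ih]; ring

lemma arrowWeight_append (l l' : List (DnLabel × DnLabel × ℤ)) (u v : DnLabel) :
    arrowWeight (l ++ l') u v = arrowWeight l u v + arrowWeight l' u v := by
  simp [arrowWeight]

lemma range_bind_cast (N : ℕ) :
    (do let a ← List.range N; pure (a : ℤ)) = (List.range N).map Nat.cast :=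
  bind_pure_comp _ _

lemma arrowWeight_map_range (N : ℕ) (x y : ℤ → DnLabel) (c : ℤ) (u v : DnLabel) :
    arrowWeight (List.map (fun k => (x k, y k, c)) (do let a ← List.range N; pure (a : ℤ))) u v =
      ∑ k ∈ Finset.range N, if x k = u ∧ y k = v then c else 0 := by
  rw [range_bind_cast]
  induction N with
  | zero => simp [arrowWeight]
  | succ N ih =>
    rw [List.range_succ, List.map_append, List.map_append, arrowWeight_append,
      ih, Finset.sum_range_succ]
    simp [arrowWeight]

lemma arrowWeight_flatMap_range (N : ℕ) (f : ℕ → List (DnLabel × DnLabel × ℤ))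
    (u v : DnLabel) :
    arrowWeight ((List.range N).flatMap f) u v = ∑ i ∈ Finset.range N, arrowWeight (f i) u v := by
  induction N with
  | zero => simp [arrowWeight]
  | succ N ih =>
    rw [List.range_succ, List.flatMap_append, arrowWeight_append, ih, Finset.sum_range_succ]
    simp

open Classical in
lemma sum_range_ite_eq_of_unique (N : ℕ) (p : ℕ → Prop) [DecidablePred p] (c : ℤ)
    (Q : Prop) [Decidable Q]
    (hu : ∀ i i', p i → p i' → i = i') (hQ : (∃ i, i < N ∧ p i) ↔ Q) :
    (∑ i ∈ Finset.range N, if p i then c else 0) = if Q then c else 0 := by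
  by_cases h : ∃ i, i < N ∧ p i
  · rw [if_pos (hQ.1 h)]
    obtain ⟨i, hi, hp⟩ := h
    rw [Finset.sum_eq_single_of_mem i (Finset.mem_range.2 hi), if_pos hp]
    exact fun j _ hj => if_neg fun h => hj (hu _ _ h hp)
  · rw [if_neg (mt hQ.2 h)]
    exact Finset.sum_eq_zero fun j hj => if_neg fun hp => h ⟨j, Finset.mem_range.1 hj, hp⟩

open Classical in
lemma sum_range_sum_range_ite_eq_of_unique (N : ℕ) (M : ℕ → ℕ) (p : ℕ → ℕ → Prop)
    [∀ i k, Decidable (p i k)] (c : ℤ) (Q : Prop) [Decidable Q]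
    (hu : ∀ i k i' k', p i k → p i' k' → i = i' ∧ k = k')
    (hQ : (∃ i k, i < N ∧ k < M i ∧ p i k) ↔ Q) :
    (∑ i ∈ Finset.range N, ∑ k ∈ Finset.range (M i), if p i k then c else 0) =
      if Q then c else 0 := by
  have h1 : ∀ i ∈ Finset.range N, (∑ k ∈ Finset.range (M i), if p i k then c else 0) =
      if ∃ k, k < M i ∧ p i k then c else 0 := fun i _ =>
    sum_range_ite_eq_of_unique _ _ _ _ (fun k k' h h' => (hu _ _ _ _ h h').2) Iff.rfl
  rw [Finset.sum_congr rfl h1]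
  refine sum_range_ite_eq_of_unique _ _ _ _ ?_ ?_
  · rintro i i' ⟨k, -, h⟩ ⟨k', -, h'⟩
    exact (hu _ _ _ _ h h').1
  · rw [← hQ]
    exact ⟨fun ⟨i, hi, k, hk, h⟩ => ⟨i, k, hi, hk, h⟩, fun ⟨i, k, hi, hk, h⟩ => ⟨i, hi, k, hk, h⟩⟩

lemma Lam_eq_V_iff (n : ℕ) (i r a b : ℤ) : Lam n i r = .V a b ↔
    (0 < r ∧ n + 1 - r = a ∧ -(n + 1 - i) = b) ∨ (r < 0 ∧ n + 1 + r = a ∧ n + 1 - i = b) := by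
  unfold Lam th
  split_ifs <;> simp <;> omega

lemma Lam_eq_C_iff (n : ℕ) (i r a : ℤ) : Lam n i r = .C a ↔ r = 0 ∧ i = a := by
  unfold Lam th
  split_ifs <;> simp <;> omega

/-- The doubled weight of the arrow from one vertex to another, in closed form. -/
def arrowVal (n : ℕ) : DnLabel → DnLabel → ℤ
  | .V a b, .V c d =>
    (if c = a ∧ d = b + 1 ∧ 1 ≤ a ∧ a ≤ n ∧ -a ≤ b ∧ b < a then 2 else 0)
    + (if (c = a + 1 ∧ d = b ∧ 1 ≤ b ∧ b ≤ a ∧ a < n) ∨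
        (a = c + 1 ∧ d = b ∧ b ≤ -1 ∧ -b ≤ c ∧ c < n) then 2 else 0)
    + (if c = a + 1 ∧ b = -a ∧ d = -c ∧ 1 ≤ a ∧ a < n then 1 else 0)
    + (if a = c + 1 ∧ b = a ∧ d = c ∧ 1 ≤ c ∧ c < n then 1 else 0)
    + (if c = a + 1 ∧ d = b - 1 ∧ b ≤ 0 ∧ -b < a ∧ a < n then 2 else 0)
    + (if a = c + 1 ∧ b = d + 1 ∧ 0 ≤ d ∧ d < c ∧ c < n then 2 else 0)
  | .V a b, .C i =>
    (if a = n ∧ b = n + 1 - i ∧ 1 ≤ i ∧ i ≤ n then 2 else 0)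
    + (if a = n ∧ b = i - n ∧ 1 ≤ i ∧ i < n then 2 else 0)
  | .C i, .V a b =>
    (if a = n ∧ b = -(n + 1 - i) ∧ 1 ≤ i ∧ i ≤ n then 2 else 0)
    + (if a = n ∧ b = n - i ∧ 1 ≤ i ∧ i < n then 2 else 0)
  | .C _, .C _ => 0

lemma arrowWeight_singleton_pair (x y z t u v : DnLabel) (c : ℤ) :
    arrowWeight [(x, y, c), (z, t, c)] u v =
      (if x = u ∧ y = v then c else 0) + (if z = u ∧ t = v then c else 0) := by
  simp [arrowWeight]

lemma arrowWeight_dnArrows_V_V (n : ℕ) (a b c d : ℤ) :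
    arrowWeight (dnArrows n) (.V a b) (.V c d) = arrowVal n (.V a b) (.V c d) := by
  simp only [dnArrows, arrowWeight_append, arrowWeight_flatMap_range, arrowWeight_map_range,
    arrowWeight_singleton_pair, Finset.sum_add_distrib, arrowVal, DnLabel.V.injEq, Lam_eq_V_iff,
    reduceCtorEq, and_false, false_and, if_false, add_zero]
  rw [← add_assoc]
  congr 1
  congr 1
  congr 1
  congr 1
  congr 1
  · refine sum_range_sum_range_ite_eq_of_unique _ _ _ _ _ (by omega) ⟨?_, fun h => ?_⟩
    · rintro ⟨i, k, h⟩; omega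
    · exact ⟨(a - 1).toNat, (a + b).toNat, by omega⟩
  · refine sum_range_sum_range_ite_eq_of_unique _ _ _ _ _ (by omega) ⟨?_, fun h => ?_⟩
    · rintro ⟨i, k, h⟩; omega
    · rcases h with h | h
      · exact ⟨(n - b).toNat, (a - b).toNat, by omega⟩
      · exact ⟨(n + b).toNat, (2 * (n + 1) - a + b).toNat, by omega⟩
  · refine sum_range_ite_eq_of_unique _ _ _ _ (by omega) ⟨?_, fun h => ?_⟩
    · rintro ⟨i, h⟩; omega
    · exact ⟨(a - 1).toNat, by omega⟩
  · refine sum_range_ite_eq_of_unique _ _ _ _ (by omega) ⟨?_, fun h => ?_⟩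
    · rintro ⟨i, h⟩; omega
    · exact ⟨(c - 1).toNat, by omega⟩
  · refine sum_range_sum_range_ite_eq_of_unique _ _ _ _ _ (by omega) ⟨?_, fun h => ?_⟩
    · rintro ⟨i, k, h⟩; omega
    · exact ⟨(a + b - 1).toNat, (-b).toNat, by omega⟩
  · refine sum_range_sum_range_ite_eq_of_unique _ _ _ _ _ (by omega) ⟨?_, fun h => ?_⟩
    · rintro ⟨i, k, h⟩; omega
    · exact ⟨(c - d - 1).toNat, d.toNat, by omega⟩

lemma arrowWeight_dnArrows_V_C (n : ℕ) (a b c : ℤ) :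
    arrowWeight (dnArrows n) (.V a b) (.C c) = arrowVal n (.V a b) (.C c) := by
  simp only [dnArrows, arrowWeight_append, arrowWeight_flatMap_range, arrowWeight_map_range,
    arrowWeight_singleton_pair, arrowVal, DnLabel.V.injEq, Lam_eq_V_iff,
    Lam_eq_C_iff, DnLabel.C.injEq,
    reduceCtorEq, and_false, if_false, Finset.sum_const_zero, add_zero, zero_add]
  congr 1
  · refine sum_range_sum_range_ite_eq_of_unique _ _ _ _ _ (by omega) ⟨?_, fun h => ?_⟩
    · rintro ⟨i, k, h⟩; omega
    · exact ⟨(c - 1).toNat, (c - 1).toNat, by omega⟩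
  · refine sum_range_ite_eq_of_unique _ _ _ _ (by omega) ⟨?_, fun h => ?_⟩
    · rintro ⟨i, h⟩; omega
    · exact ⟨(c - 1).toNat, by omega⟩

lemma arrowWeight_dnArrows_C_V (n : ℕ) (a b c : ℤ) :
    arrowWeight (dnArrows n) (.C c) (.V a b) = arrowVal n (.C c) (.V a b) := by
  simp only [dnArrows, arrowWeight_append, arrowWeight_flatMap_range, arrowWeight_map_range,
    arrowWeight_singleton_pair, arrowVal, DnLabel.V.injEq, Lam_eq_V_iff,
    Lam_eq_C_iff, DnLabel.C.injEq,
    reduceCtorEq, and_false, false_and, if_false, Finset.sum_const_zero, add_zero, zero_add]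
  congr 1
  · refine sum_range_sum_range_ite_eq_of_unique _ _ _ _ _ (by omega) ⟨?_, fun h => ?_⟩
    · rintro ⟨i, k, h⟩; omega
    · exact ⟨(c - 1).toNat, c.toNat, by omega⟩
  · refine sum_range_ite_eq_of_unique _ _ _ _ (by omega) ⟨?_, fun h => ?_⟩
    · rintro ⟨i, h⟩; omega
    · exact ⟨(c - 1).toNat, by omega⟩

lemma arrowWeight_dnArrows_C_C (n : ℕ) (a c : ℤ) :
    arrowWeight (dnArrows n) (.C c) (.C a) = arrowVal n (.C c) (.C a) := by
  simp only [dnArrows, arrowWeight_append, arrowWeight_flatMap_range, arrowWeight_map_range,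
    arrowWeight_singleton_pair, arrowVal,
    Lam_eq_C_iff, DnLabel.C.injEq,
    reduceCtorEq, and_false, false_and, if_false, Finset.sum_const_zero, add_zero, zero_add]
  exact Finset.sum_eq_zero fun i _ => Finset.sum_eq_zero fun k _ => if_neg (by omega)

lemma eps2_eq_arrowVal_sub (n : ℕ) (u v : DnLabel) :
    eps2 n u v = arrowVal n u v - arrowVal n v u := by
  rw [eps2_eq_arrowWeight_sub]
  cases u <;> cases v <;> simp only [arrowWeight_dnArrows_V_V, arrowWeight_dnArrows_V_C,
    arrowWeight_dnArrows_C_V, arrowWeight_dnArrows_C_C]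

/-- The doubled exchange matrix entry between position `a` of row `k` and position `b` of
row `k + 1`. -/
def adjVal (k a b : ℤ) : ℤ :=
  (if a = -k ∧ b = a - 1 then 1 else 0)
  + (if -k < a ∧ a ≤ 0 ∧ b = a - 1 then 2 else 0)
  + (if 0 < a ∧ b = a then 2 else 0)
  - (if a < 0 ∧ b = a then 2 else 0)
  - (if 0 ≤ a ∧ b = a + 1 then 2 else 0)

lemma eps2_V_adj {n : ℕ} {k a b : ℤ} (hk : 1 ≤ k) (hkn : k + 1 ≤ n)
    (ha : -k ≤ a) (ha' : a < k) :
    eps2 n (.V k a) (.V (k + 1) b) = adjVal k a b := by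
  rw [eps2_eq_arrowVal_sub]
  simp only [arrowVal, adjVal]
  grind (splits := 60)

lemma eps2_V_far {n : ℕ} {k l a b : ℤ} (hkl : k + 2 ≤ l) :
    eps2 n (.V k a) (.V l b) = 0 := by
  rw [eps2_eq_arrowVal_sub]
  simp only [arrowVal]
  grind (splits := 60)

lemma eps2_Lam_adj {n : ℕ} {k a b : ℤ} (hk : 1 ≤ k) (hkn : k + 1 ≤ n)
    (ha : -k ≤ a) (ha' : a < k) (hb : -(k + 1) ≤ b) (hb' : b < k + 1) :
    eps2 n (Lam n k a) (Lam n (k + 1) b) = adjVal k a b := by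
  rw [eps2_eq_arrowVal_sub]
  unfold Lam th
  split_ifs <;> simp only [arrowVal, adjVal] <;> grind (splits := 60)

lemma eps2_Lam_far {n : ℕ} {k l a b : ℤ} (hkl : k + 2 ≤ l) (hl : l ≤ n)
    (ha : -k ≤ a) (ha' : a < k) (hb : -l ≤ b) (hb' : b < l) :
    eps2 n (Lam n k a) (Lam n l b) = 0 := by
  rw [eps2_eq_arrowVal_sub]
  unfold Lam th
  split_ifs <;> simp only [arrowVal] <;> grind (splits := 60)

lemma sum_range_adjVal {k a : ℤ} (hk : 1 ≤ k) (ha : -k ≤ a) (M : ℕ) :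
    ∑ t ∈ Finset.range M, adjVal k a (-(k + 1) + t) =
      if M = 0 then 0 else
        (if a = -k then (if M = 1 then 1 else -1) else 0)
        + (if -k < a ∧ a < 0 ∧ M = a + k + 1 then 2 else 0)
        + (if a = 0 ∧ (M = k + 1 ∨ M = k + 2) then 2 else 0)
        + (if 0 < a ∧ M = a + k + 2 then 2 else 0) := by
  induction M with
  | zero => simp
  | succ M ih =>
    rw [Finset.sum_range_succ, ih]
    simp only [adjVal]
    push_cast
    grind (splits := 60)

lemma sum_range_sum_range_adjVal {k : ℤ} (hk : 1 ≤ k) {M N : ℕ} (hM : 1 ≤ M) (hN : N ≤ 2 * k) :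
    ∑ p ∈ Finset.range N, ∑ t ∈ Finset.range M, adjVal k (-k + p) (-(k + 1) + t) =
      if N = 0 then 0 else
        if M = 1 ∨ ((M : ℤ) ≤ k + 1 ∧ M ≤ N) ∨ (k + 2 ≤ (M : ℤ) ∧ M ≤ N + 1) then 1 else -1 := by
  induction N with
  | zero => simp
  | succ N ih =>
    push_cast at hN
    rw [Finset.sum_range_succ, ih (by omega), sum_range_adjVal hk (by omega)]
    push_cast
    grind (splits := 60)

section

variable {K A : Type*} [Field K] [Ring A] [Algebra K A]

lemma mul_prod_range_eq_zpow_smul {q : K} (hq : q ≠ 0) (x : A) (y : ℕ → A) (e : ℕ → ℤ) (M : ℕ)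
    (h : ∀ b < M, y b * x = q ^ e b • (x * y b)) :
    ((List.range M).map y).prod * x =
      q ^ (∑ b ∈ Finset.range M, e b) • (x * ((List.range M).map y).prod) := by
  induction M with
  | zero => simp
  | succ M ih =>
    rw [List.range_succ, List.map_append, List.prod_append, List.map_singleton,
      List.prod_singleton, mul_assoc, h M (by omega), mul_smul_comm, ← mul_assoc,
      ih fun b hb => h b (by omega), Finset.sum_range_succ, smul_mul_assoc, smul_smul,
      ← zpow_add₀ hq, mul_assoc, add_comm (e M)]

lemma prod_range_mul_prod_range_eq_zpow_smul {q : K} (hq : q ≠ 0) (x y : ℕ → A)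
    (e : ℕ → ℕ → ℤ) (M N : ℕ) (h : ∀ a < N, ∀ b < M, y b * x a = q ^ e a b • (x a * y b)) :
    ((List.range M).map y).prod * ((List.range N).map x).prod =
      q ^ (∑ a ∈ Finset.range N, ∑ b ∈ Finset.range M, e a b) •
        (((List.range N).map x).prod * ((List.range M).map y).prod) := by
  induction N with
  | zero => simp
  | succ N ih =>
    rw [List.range_succ, List.map_append, List.prod_append, List.map_singleton,
      List.prod_singleton, ← mul_assoc, ih fun a ha => h a (by omega), smul_mul_assoc,
      mul_assoc, mul_prod_range_eq_zpow_smul hq _ _ _ _ (h N (by omega)),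
      Finset.sum_range_succ, mul_smul_comm, smul_smul, ← zpow_add₀ hq, mul_assoc]

/-- Uniqueness of the decomposition into a `q⁻¹`-commuting and a `q`-commuting part. -/
lemma eq_of_add_eq_add_of_mul_eq_smul {q : K} (hq : q - q⁻¹ ≠ 0) {y a b a' b' : A}
    (hy : IsUnit y) (h : a + b = a' + b')
    (ha : y * a = q⁻¹ • (a * y)) (hb : y * b = q • (b * y))
    (ha' : y * a' = q⁻¹ • (a' * y)) (hb' : y * b' = q • (b' * y)) : a = a' ∧ b = b' := by
  have e1 : a - a' = b' - b := by rw [sub_eq_sub_iff_add_eq_add, h, add_comm]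
  have e2 : y * (a - a') = q⁻¹ • ((a - a') * y) := by rw [mul_sub, sub_mul, smul_sub, ha, ha']
  have e3 : y * (a - a') = q • ((a - a') * y) := by
    rw [e1, mul_sub, sub_mul, smul_sub, hb, hb']
  have e4 : (q - q⁻¹) • ((a - a') * y) = 0 := by rw [sub_smul, ← e2, ← e3, sub_self]
  have e5 : a - a' = 0 :=
    hy.mul_left_eq_zero.1 ((smul_eq_zero_iff_right hq).1 e4)
  exact ⟨sub_eq_zero.1 e5, (sub_eq_zero.1 (e1 ▸ e5)).symm⟩

lemma smul_sub_smul_eq (u q : K) (x y : A) : u • (x - q • y) = u • x + (-(q * u)) • y := by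
  module

lemma neg_smul_eq_neg_smul (q : K) (x : A) : (-q) • x = -(q • x) :=
  neg_smul q x

end

lemma qq_ne_zero : qq ≠ 0 := RatFunc.X_ne_zero

lemma qq_sub_inv_ne_zero : qq - qq⁻¹ ≠ 0 := by
  intro h
  have h1 : qq * qq = 1 := by
    have := sub_eq_zero.1 h
    nth_rewrite 2 [this]
    exact mul_inv_cancel₀ qq_ne_zero
  have h2 : (Polynomial.X * Polynomial.X : Polynomial ℂ) = 1 := by
    apply RatFunc.algebraMap_injective ℂ
    simpa [qq] using h1
  have := congrArg Polynomial.natDegree h2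
  simp at this

lemma ii_ne_zero : ii ≠ 0 := by
  simp [ii]

lemma Xg_mul_Xg {n : ℕ} {u v : DnLabel} (hu : u.valid n) (hv : v.valid n) :
    Xg n v * Xg n u = qq ^ eps2 n u v • (Xg n u * Xg n v) := by
  have h := RingQuot.mkAlgHom_rel Kq (DnRel.comm (n := n) ⟨v, hv⟩ ⟨u, hu⟩)
  simpa only [map_mul, map_smul, Xg, dif_pos hu, dif_pos hv] using h

lemma isUnit_Xg (n : ℕ) (v : DnLabel) : IsUnit (Xg n v) := by
  by_cases hv : v.valid n
  · have h1 := RingQuot.mkAlgHom_rel Kq (DnRel.mul_inv (n := n) ⟨v, hv⟩)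
    have h2 := RingQuot.mkAlgHom_rel Kq (DnRel.inv_mul (n := n) ⟨v, hv⟩)
    rw [map_mul, map_one] at h1 h2
    rw [Xg, dif_pos hv]
    exact ⟨⟨_, _, h1, h2⟩, rfl⟩
  · rw [Xg, dif_neg hv]
    exact isUnit_one

lemma isUnit_prod_range {M : Type*} [Monoid M] (x : ℕ → M) (hx : ∀ k, IsUnit (x k)) (N : ℕ) :
    IsUnit ((List.range N).map x).prod := by
  induction N with
  | zero => simp
  | succ N ih => simpa [List.range_succ] using ih.mul (hx N)

lemma isUnit_scalar_smul (n : ℕ) (e : ℤ) {x : Dtorus n} (hx : IsUnit x) :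
    IsUnit ((ii * qq ^ e) • x) :=
  hx.smul (Units.mk0 (ii * qq ^ e) (mul_ne_zero ii_ne_zero (zpow_ne_zero _ qq_ne_zero)))

lemma ww_eq (n : ℕ) (i r : ℤ) : ww n i r = (ii * qq ^ (i + r)) •
    ((List.range (r + i + 1).toNat).map fun p : ℕ => Xg n (.V i (-i + p))).prod := by
  rw [ww, Vprod, range_bind_cast, List.map_map]
  rfl

lemma mm_eq (n : ℕ) (i r : ℤ) : mm n i r = (ii * qq ^ (i + r)) •
    ((List.range (r + i + 1).toNat).map fun p : ℕ => Xg n (Lam n i (-i + p))).prod := by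
  rw [mm, Lprod, range_bind_cast, List.map_map]
  rfl

lemma isUnit_ww (n : ℕ) (i r : ℤ) : IsUnit (ww n i r) :=
  ww_eq n i r ▸ isUnit_scalar_smul n _ (isUnit_prod_range _ (fun _ => isUnit_Xg n _) _)

lemma isUnit_mm (n : ℕ) (i r : ℤ) : IsUnit (mm n i r) :=
  mm_eq n i r ▸ isUnit_scalar_smul n _ (isUnit_prod_range _ (fun _ => isUnit_Xg n _) _)

lemma decompPM_eq {n : ℕ} {y a b : Dtorus n} (hy : IsUnit y)
    (ha : y * a = qq⁻¹ • (a * y)) (hb : y * b = qq • (b * y)) :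
    decompPM n y (a + b) = (a, b) := by
  have h : ∃ p : Dtorus n × Dtorus n,
      a + b = p.1 + p.2 ∧ y * p.1 = qq⁻¹ • (p.1 * y) ∧ y * p.2 = qq • (p.2 * y) :=
    ⟨(a, b), rfl, ha, hb⟩
  rw [decompPM, dif_pos h]
  obtain ⟨h1, h2, h3⟩ := h.choose_spec
  generalize h.choose = p at h1 h2 h3
  obtain ⟨e1, e2⟩ := eq_of_add_eq_add_of_mul_eq_smul qq_sub_inv_ne_zero hy h1 ha hb h2 h3
  exact Prod.ext e1.symm e2.symm

lemma smul_mul_smul_comm_zpow {n : ℕ} (α β : Kq) {x y : Dtorus n} {e : ℤ}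
    (h : y * x = qq ^ e • (x * y)) :
    (β • y) * (α • x) = qq ^ e • ((α • x) * (β • y)) := by
  rw [smul_mul_smul_comm, smul_mul_smul_comm, h, smul_comm, mul_comm]

lemma V_valid {n : ℕ} {k a : ℤ} (hk : 1 ≤ k) (hkn : k ≤ n) (ha : -k ≤ a) (ha' : a ≤ k) :
    (DnLabel.V k a).valid n := ⟨hk, hkn, ha, ha'⟩

lemma Lam_valid {n : ℕ} {k a : ℤ} (hk : 1 ≤ k) (hkn : k ≤ n) (ha : -k ≤ a) (ha' : a ≤ k) :
    (Lam n k a).valid n := by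
  unfold Lam th
  split_ifs <;> simp only [DnLabel.valid] <;> omega

section

variable {n : ℕ} {L : ℤ → ℤ → DnLabel}

lemma path_prod_mul_adj
    (hvalid : ∀ k a : ℤ, 1 ≤ k → k ≤ n → -k ≤ a → a ≤ k → (L k a).valid n)
    (hadj : ∀ k a b : ℤ, 1 ≤ k → k + 1 ≤ n → -k ≤ a → a < k → -(k + 1) ≤ b → b < k + 1 →
      eps2 n (L k a) (L (k + 1) b) = adjVal k a b)
    {k r s : ℤ} (hk : 1 ≤ k) (hkn : k + 1 ≤ n) (hr : r ∈ Finset.Icc (-k) (k - 1))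
    (hs : s ∈ Finset.Icc (-(k + 1)) (k + 1 - 1)) (α β : Kq) :
    let x := α • ((List.range (r + k + 1).toNat).map fun p : ℕ => Xg n (L k (-k + p))).prod
    let y := β • ((List.range (s + (k + 1) + 1).toNat).map
      fun p : ℕ => Xg n (L (k + 1) (-(k + 1) + p))).prod
    y * x = qq • (x * y) ∨ y * x = qq⁻¹ • (x * y) := by
  intro x y
  rw [Finset.mem_Icc] at hr hs
  have h := smul_mul_smul_comm_zpow α β <| prod_range_mul_prod_range_eq_zpow_smul qq_ne_zero
    (fun p : ℕ => Xg n (L k (-k + p))) (fun p : ℕ => Xg n (L (k + 1) (-(k + 1) + p)))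
    (fun p t => adjVal k (-k + p) (-(k + 1) + t)) (s + (k + 1) + 1).toNat (r + k + 1).toNat
    (fun a ha b hb => by
      rw [Xg_mul_Xg (hvalid _ _ hk (by omega) (by omega) (by omega))
        (hvalid _ _ (by omega) hkn (by omega) (by omega)),
        hadj k _ _ hk hkn (by omega) (by omega) (by omega) (by omega)])
  rw [sum_range_sum_range_adjVal hk (by omega) (by omega), if_neg (by omega)] at h
  split_ifs at h
  · exact Or.inl (by simpa only [zpow_one] using h)
  · exact Or.inr (by simpa only [zpow_neg_one] using h)

lemma path_prod_commute_far
    (hvalid : ∀ k a : ℤ, 1 ≤ k → k ≤ n → -k ≤ a → a ≤ k → (L k a).valid n)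
    (hfar : ∀ k l a b : ℤ, k + 2 ≤ l → l ≤ n → -k ≤ a → a < k → -l ≤ b → b < l →
      eps2 n (L k a) (L l b) = 0)
    {k l r s : ℤ} (hk : 1 ≤ k) (hkl : k + 2 ≤ l) (hln : l ≤ n)
    (hr : r ∈ Finset.Icc (-k) (k - 1)) (hs : s ∈ Finset.Icc (-l) (l - 1)) (α β : Kq) :
    Commute (β • ((List.range (s + l + 1).toNat).map fun p : ℕ => Xg n (L l (-l + p))).prod)
      (α • ((List.range (r + k + 1).toNat).map fun p : ℕ => Xg n (L k (-k + p))).prod) := by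
  rw [Finset.mem_Icc] at hr hs
  have h := smul_mul_smul_comm_zpow α β <| prod_range_mul_prod_range_eq_zpow_smul qq_ne_zero
    (fun p : ℕ => Xg n (L k (-k + p))) (fun p : ℕ => Xg n (L l (-l + p)))
    (fun _ _ => 0) (s + l + 1).toNat (r + k + 1).toNat
    (fun a ha b hb => by
      rw [Xg_mul_Xg (hvalid _ _ hk (by omega) (by omega) (by omega))
        (hvalid _ _ (by omega) hln (by omega) (by omega)),
        hfar k l _ _ hkl hln (by omega) (by omega) (by omega) (by omega)])
  simp only [Finset.sum_const_zero, zpow_zero, one_smul] at h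
  exact h

end

lemma ww_mul_ww_adj {n : ℕ} {k r s : ℤ} (hk : 1 ≤ k) (hkn : k + 1 ≤ n)
    (hr : r ∈ Finset.Icc (-k) (k - 1)) (hs : s ∈ Finset.Icc (-(k + 1)) (k + 1 - 1)) :
    ww n (k + 1) s * ww n k r = qq • (ww n k r * ww n (k + 1) s) ∨
      ww n (k + 1) s * ww n k r = qq⁻¹ • (ww n k r * ww n (k + 1) s) := by
  simp only [ww_eq]
  exact path_prod_mul_adj (fun _ _ => V_valid)
    (fun _ _ _ h1 h2 h3 h4 _ _ => eps2_V_adj h1 h2 h3 h4) hk hkn hr hs _ _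

lemma mm_mul_mm_adj {n : ℕ} {k r s : ℤ} (hk : 1 ≤ k) (hkn : k + 1 ≤ n)
    (hr : r ∈ Finset.Icc (-k) (k - 1)) (hs : s ∈ Finset.Icc (-(k + 1)) (k + 1 - 1)) :
    mm n (k + 1) s * mm n k r = qq • (mm n k r * mm n (k + 1) s) ∨
      mm n (k + 1) s * mm n k r = qq⁻¹ • (mm n k r * mm n (k + 1) s) := by
  simp only [mm_eq]
  exact path_prod_mul_adj (fun _ _ => Lam_valid)
    (fun _ _ _ => eps2_Lam_adj) hk hkn hr hs _ _

lemma commute_ww_far {n : ℕ} {k l r s : ℤ} (hk : 1 ≤ k) (hkl : k + 2 ≤ l) (hln : l ≤ n)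
    (hr : r ∈ Finset.Icc (-k) (k - 1)) (hs : s ∈ Finset.Icc (-l) (l - 1)) :
    Commute (ww n l s) (ww n k r) := by
  simp only [ww_eq]
  exact path_prod_commute_far (fun _ _ => V_valid)
    (fun _ _ _ _ h _ _ _ _ _ => eps2_V_far h) hk hkl hln hr hs _ _

lemma commute_mm_far {n : ℕ} {k l r s : ℤ} (hk : 1 ≤ k) (hkl : k + 2 ≤ l) (hln : l ≤ n)
    (hr : r ∈ Finset.Icc (-k) (k - 1)) (hs : s ∈ Finset.Icc (-l) (l - 1)) :
    Commute (mm n l s) (mm n k r) := by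
  simp only [mm_eq]
  exact path_prod_commute_far (fun _ _ => Lam_valid)
    (fun _ _ _ _ => eps2_Lam_far) hk hkl hln hr hs _ _

lemma EE_self (n : ℕ) (i : ℤ) : EE n i i = Ev n i := by
  simp [EE, EEaux]

lemma EE_succ (n : ℕ) {i j : ℤ} (hij : i ≤ j) :
    EE n i (j + 1) = (qq - qq⁻¹)⁻¹ • (EE n i j * EE n (j + 1) (j + 1)) +
      (-(qq * (qq - qq⁻¹)⁻¹)) • (EE n (j + 1) (j + 1) * EE n i j) := by
  obtain ⟨m, rfl⟩ : ∃ m : ℕ, j = i + m := ⟨(j - i).toNat, by omega⟩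
  have e1 : (i + m + 1 - i).toNat = m + 1 := by omega
  have e2 : (i + m - i).toNat = m := by omega
  rw [EE_self, EE, EE, e1, e2, EEaux]
  exact smul_sub_smul_eq (K := Kq) (A := Dtorus n) _ _ _ _

lemma FF_self (n : ℕ) (i : ℤ) : FF n i i = Fv n i := by
  simp [FF, FFaux]

lemma FF_succ (n : ℕ) {i j : ℤ} (hij : i ≤ j) :
    FF n i (j + 1) = (-(qq⁻¹ * (qq - qq⁻¹)⁻¹)) • (FF n i j * FF n (j + 1) (j + 1)) +
      (qq - qq⁻¹)⁻¹ • (FF n (j + 1) (j + 1) * FF n i j) := by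
  obtain ⟨m, rfl⟩ : ∃ m : ℕ, j = i + m := ⟨(j - i).toNat, by omega⟩
  have e1 : (i + m + 1 - i).toNat = m + 1 := by omega
  have e2 : (i + m - i).toNat = m := by omega
  rw [FF_self, FF, FF, e1, e2, FFaux]
  exact (smul_sub_smul_eq (K := Kq) (A := Dtorus n) _ _ _ _).trans (add_comm _ _)

/-- The decompositions of the quantum root vectors `E_{i,j}` (resp.
`F_{i,j}`) with respect to the `V_i`-, `V_r`-, `V_j`-paths (resp. the `Λ_{θ(i)}`-,
`Λ_{θ(r)}`-, `Λ_{θ(j)}`-paths). -/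
theorem statement9 (n : ℕ) (hn : 1 ≤ n) (i j : ℤ) (h1 : 1 ≤ i) (hij : i < j) (hj : j ≤ (n : ℤ)) :
    (EE n i j = -(qq • ∑ s ∈ Finset.Icc (-j) (j - 1), (Eup n i (j - 1) s).2 * ww n j s)) ∧
    (EE n i j = -(qq • ∑ s ∈ Finset.Icc (-i) (i - 1), ww n i s * (Edown n (i + 1) j s).1)) ∧
    (∀ r : ℤ, i < r → r < j →
      EE n i j = (qq ^ (2 : ℤ)) •
        ∑ s ∈ Finset.Icc (-r) (r - 1),
          (Eup n i (r - 1) s).2 * ww n r s * (Edown n (r + 1) j s).1) ∧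
    (FF n i j = ∑ s ∈ Finset.Icc (-(th n j)) (th n j - 1),
      (Fup n i (j - 1) s).2 * mm n (th n j) s) ∧
    (FF n i j = ∑ s ∈ Finset.Icc (-(th n i)) (th n i - 1),
      mm n (th n i) s * (Fdown n (i + 1) j s).1) ∧
    (∀ r : ℤ, i < r → r < j →
      FF n i j = ∑ s ∈ Finset.Icc (-(th n r)) (th n r - 1),
        (Fup n i (r - 1) s).2 * mm n (th n r) s * (Fdown n (r + 1) j s).1) := by
  have hq := qq_ne_zero
  have hd := qq_sub_inv_ne_zero
  have hc : (qq - qq⁻¹)⁻¹ + -(qq * (qq - qq⁻¹)⁻¹) * qq = -qq := by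
    linear_combination (-qq) * mul_inv_cancel₀ hd - (qq - qq⁻¹)⁻¹ * mul_inv_cancel₀ hq
  have hz : (qq - qq⁻¹)⁻¹ + -(qq * (qq - qq⁻¹)⁻¹) * qq⁻¹ = 0 := by
    linear_combination (-(qq - qq⁻¹)⁻¹) * mul_inv_cancel₀ hq
  have hc' : -(qq⁻¹ * (qq - qq⁻¹)⁻¹) + (qq - qq⁻¹)⁻¹ * qq = 1 := by
    linear_combination mul_inv_cancel₀ hd
  have hz' : -(qq⁻¹ * (qq - qq⁻¹)⁻¹) + (qq - qq⁻¹)⁻¹ * qq⁻¹ = 0 := by ring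
  obtain ⟨E1, E2, E3⟩ := rootVector_path_decomposition (n := n)
    (I := fun k => Finset.Icc (-k) (k - 1)) (w := ww n) (X := EE n) (D := decompPM n) hc hz hq
    (fun k l hk hkl hl r hr s hs => commute_ww_far hk hkl hl hr hs)
    (fun k hk hkn r hr s hs => ww_mul_ww_adj hk hkn hr hs)
    (fun i => EE_self n i) (fun i j h => EE_succ n h)
    (fun k s a b => decompPM_eq (isUnit_ww n k s)) h1 hij hj
  obtain ⟨F1, F2, F3⟩ := rootVector_path_decomposition (n := n)
    (I := fun k => Finset.Icc (-(th n k)) (th n k - 1)) (w := fun k => mm n (th n k))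
    (X := FF n) (D := decompPM n) hc' hz' hq
    (fun k l hk hkl hl r hr s hs => (commute_mm_far (by unfold th; omega)
      (by unfold th; omega) (by unfold th; omega) hs hr).symm)
    (fun k hk hkn r hr s hs => by
      have e : th n k = th n (k + 1) + 1 := by unfold th; ring
      simp only [e] at hr ⊢
      have a1 : 1 ≤ th n (k + 1) := by unfold th; omega
      have a2 : th n (k + 1) + 1 ≤ (n : ℤ) := by unfold th; omega
      rcases mm_mul_mm_adj a1 a2 hs hr with h | h
      · right; rw [h, smul_smul, inv_mul_cancel₀ hq, one_smul]
      · left; rw [h, smul_smul, mul_inv_cancel₀ hq, one_smul])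
    (fun i => FF_self n i) (fun i j h => FF_succ n h)
    (fun k s a b => decompPM_eq (isUnit_mm n _ s)) h1 hij hj
  simp only [Eup, Edown, Fup, Fdown, sub_add_cancel, add_sub_cancel_right]
  refine ⟨?_, ?_, fun r hir hrj => ?_, ?_, ?_, fun r hir hrj => ?_⟩
  · exact E1.trans (neg_smul_eq_neg_smul (K := Kq) (A := Dtorus n) _ _)
  · exact E2.trans (neg_smul_eq_neg_smul (K := Kq) (A := Dtorus n) _ _)
  · have e : qq ^ (2 : ℤ) = -qq * -qq := by rw [neg_mul_neg, ← pow_two]; rfl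
    rw [e]; exact E3 r hir hrj
  · simpa only [one_smul] using F1
  · simpa only [one_smul] using F2
  · simpa only [mul_one, one_smul] using F3 r hir hrj

end
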